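/- arXiv:2005.11207 — 7 statements merged into one kernel-verified Lean document; each statement's English description precedes it below -/
import Mathlib

section
/- Let G be a quasiassociative quasigroup. Then for all g, h, k, l ∈ G the associator satisfies the 3-cocycle condition (((g·β(h,k,l))·g⁻¹)·β(g,h·k,l))·β(g,h,k) = β(g,h,k·l)·β(g·h,k,l). (All factors (g·β(h,k,l))·g⁻¹, β(g,h·k,l), β(g,h,k), β(g,h,k·l), β(g·h,k,l) lie in the nucleus N(G), so the bracketing of these products is immaterial.) -/
/-- A quasigroup (in the sense of the paper): a type with a multiplication,
a two-sided identity, and an inverse operation satisfying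
`g⁻¹ * (g * h) = h` and `(h * g⁻¹) * g = h`. -/
class PaperQuasigroup (G : Type*) extends Mul G, One G, Inv G where
  one_mul : ∀ g : G, 1 * g = g
  mul_one : ∀ g : G, g * 1 = g
  inv_mul_cancel_left : ∀ g h : G, g⁻¹ * (g * h) = h
  mul_inv_cancel_right : ∀ g h : G, (h * g⁻¹) * g = h

/-- The nucleus `N(G)` of associative elements of a quasigroup. -/
def PaperQuasigroup.nucleus (G : Type*) [PaperQuasigroup G] : Set G :=
  {a | ∀ g h : G,
    (a * g) * h = a * (g * h) ∧ (g * a) * h = g * (a * h) ∧ (g * h) * a = g * (h * a)}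

/-- The multiplicative associator `β(g,h,k) = (g·(h·k))·((g·h)·k)⁻¹`. -/
def PaperQuasigroup.associator {G : Type*} [PaperQuasigroup G] (g h k : G) : G :=
  (g * (h * k)) * ((g * h) * k)⁻¹

/-- A quasigroup is quasiassociative if the associator takes values in the nucleus
and the nucleus is stable under conjugation. -/
def PaperQuasigroup.IsQuasiassociative (G : Type*) [PaperQuasigroup G] : Prop :=
  (∀ g h k : G, PaperQuasigroup.associator g h k ∈ PaperQuasigroup.nucleus G) ∧
  (∀ g a : G, a ∈ PaperQuasigroup.nucleus G → (g * a) * g⁻¹ ∈ PaperQuasigroup.nucleus G)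

namespace PaperQuasigroup

variable {G : Type*} [PaperQuasigroup G]

theorem inv_inv_eq (g : G) : g⁻¹⁻¹ = g := by
  have h₁ : g⁻¹⁻¹ * g⁻¹ = 1 := by
    simpa only [PaperQuasigroup.mul_one] using inv_mul_cancel_left g⁻¹ (1 : G)
  have h₂ := mul_inv_cancel_right g g⁻¹⁻¹
  rw [h₁, PaperQuasigroup.one_mul] at h₂
  exact h₂.symm

theorem mul_mul_inv_cancel (h g : G) : (h * g) * g⁻¹ = h := by
  simpa only [inv_inv_eq] using mul_inv_cancel_right g⁻¹ h

theorem mul_right_cancel_of_eq {x y g : G} (h : x * g = y * g) : x = y := by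
  rw [← mul_mul_inv_cancel x g, h, mul_mul_inv_cancel]

theorem associator_mul (g h k : G) : associator g h k * ((g * h) * k) = g * (h * k) :=
  mul_inv_cancel_right _ _

theorem mul_assoc_of_mem_nucleus_left {a : G} (ha : a ∈ nucleus G) (g h : G) :
    (a * g) * h = a * (g * h) :=
  (ha g h).1

theorem mul_assoc_of_mem_nucleus_middle {a : G} (ha : a ∈ nucleus G) (g h : G) :
    (g * a) * h = g * (a * h) :=
  (ha g h).2.1

end PaperQuasigroup

open PaperQuasigroup in
/-- The 3-cocycle condition for the associator of a quasiassociative quasigroup. -/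
theorem quasiassociative_associator_three_cocycle
    {G : Type*} [PaperQuasigroup G] (hG : IsQuasiassociative G) (g h k l : G) :
    ((g * associator h k l) * g⁻¹ * associator g (h * k) l) * associator g h k
      = associator g h (k * l) * associator (g * h) k l := by
  obtain ⟨hβ, hconj⟩ := hG
  have hc := hconj g _ (hβ h k l)
  apply mul_right_cancel_of_eq (g := ((g * h) * k) * l)
  calc _ = (g * associator h k l) * g⁻¹ *
        (associator g (h * k) l * ((associator g h k * ((g * h) * k)) * l)) := by
        rw [mul_assoc_of_mem_nucleus_middle (hβ g h k), mul_assoc_of_mem_nucleus_left hc,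
          mul_assoc_of_mem_nucleus_left (hβ g h k)]
    _ = ((g * associator h k l) * g⁻¹ * g) * ((h * k) * l) := by
        rw [associator_mul, associator_mul, mul_assoc_of_mem_nucleus_left hc]
    _ = g * (h * (k * l)) := by
        rw [PaperQuasigroup.mul_inv_cancel_right, mul_assoc_of_mem_nucleus_middle (hβ h k l), associator_mul]
    _ = _ := by
        rw [mul_assoc_of_mem_nucleus_left (hβ g h (k * l)), associator_mul, associator_mul]
end

section
/- Let G be a quasigroup with nucleus N(G). For n ≥ 1, call a map p : Gⁿ → G an iterated product if it is obtained from a full binary tree with n leaves by placing the n arguments at the leaves in left-to-right order and multiplying according to the tree structure (for n = 1, p is the identity). Suppose p, q : Gⁿ → G are iterated products and 1 ≤ m ≤ n is such that p(g₁,…,g_{m-1},1,g_{m+1},…,g_n) = q(g₁,…,g_{m-1},1,g_{m+1},…,g_n) for all g₁,…,g_n ∈ G. Then p(g₁,…,g_{m-1},x,g_{m+1},…,g_n) = q(g₁,…,g_{m-1},x,g_{m+1},…,g_n) for all g₁,…,g_n ∈ G and all x ∈ N(G). -/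
/-- Full binary trees with `n` leaves, encoding iterated products of `n` arguments. -/
inductive MulTree : ℕ → Type
  | leaf : MulTree 1
  | node : {m n : ℕ} → MulTree m → MulTree n → MulTree (m + n)

/-- Evaluation of an iterated product: the `n` arguments are placed at the leaves
in left-to-right order and multiplied according to the tree structure. -/
def MulTree.eval {G : Type*} [PaperQuasigroup G] : {n : ℕ} → MulTree n → (Fin n → G) → G
  | _, .leaf, args => args 0
  | _, .node t₁ t₂, args =>
      t₁.eval (fun i => args (Fin.castAdd _ i)) * t₂.eval (fun j => args (Fin.natAdd _ j))

namespace MulTree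

theorem pos {n : ℕ} (t : MulTree n) : 0 < n := by
  induction t with
  | leaf => exact Nat.one_pos
  | node _ _ ih₁ _ => exact Nat.add_pos_left ih₁ _

variable {G : Type*} [PaperQuasigroup G]

/-- A nuclear factor at the first leaf can be pulled out to the left. -/
theorem eval_eq_mul_eval_of_first {x : G} (hx : x ∈ PaperQuasigroup.nucleus G) {n : ℕ}
    (t : MulTree n) (a b : Fin n → G) (h₀ : ∀ i : Fin n, i.val = 0 → a i = x * b i)
    (h : ∀ i : Fin n, i.val ≠ 0 → a i = b i) : t.eval a = x * t.eval b := by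
  induction t with
  | leaf => exact h₀ 0 rfl
  | node t₁ t₂ ih₁ ih₂ =>
    have hpos := t₁.pos
    simp only [eval]
    rw [ih₁ _ (fun i => b (Fin.castAdd _ i)) (fun i hi => h₀ _ hi) (fun i hi => h _ hi), (hx _ _).1]
    congr 3
    funext j
    exact h _ (by simp only [Fin.val_natAdd]; omega)

/-- A nuclear factor at the last leaf can be pulled out to the right. -/
theorem eval_eq_eval_mul_of_last {x : G} (hx : x ∈ PaperQuasigroup.nucleus G) {n : ℕ}
    (t : MulTree n) (a b : Fin n → G) (h₀ : ∀ i : Fin n, i.val + 1 = n → a i = b i * x)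
    (h : ∀ i : Fin n, i.val + 1 ≠ n → a i = b i) : t.eval a = t.eval b * x := by
  induction t with
  | leaf => exact h₀ 0 rfl
  | @node k l t₁ t₂ ih₁ ih₂ =>
    have hpos := t₂.pos
    simp only [eval]
    rw [ih₂ _ (fun i => b (Fin.natAdd _ i))
      (fun i hi => h₀ _ (by simp only [Fin.val_natAdd]; omega))
      (fun i hi => h _ (by simp only [Fin.val_natAdd]; omega)), (hx _ _).2.2]
    congr 2
    funext j
    exact h _ (by have := j.isLt; simp only [Fin.val_castAdd]; omega)

/-- A nuclear factor on the left of leaf `k + 1` can be moved to the right of leaf `k`. -/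
theorem eval_eq_eval_of_shift {x : G} (hx : x ∈ PaperQuasigroup.nucleus G) {n : ℕ}
    (t : MulTree n) (k : ℕ) (hk : k + 1 < n) (a b : Fin n → G)
    (hleft : ∀ i : Fin n, i.val = k → b i = a i * x)
    (hright : ∀ i : Fin n, i.val = k + 1 → a i = x * b i)
    (h : ∀ i : Fin n, i.val ≠ k → i.val ≠ k + 1 → a i = b i) : t.eval a = t.eval b := by
  induction t generalizing k with
  | leaf => omega
  | @node r s t₁ t₂ ih₁ ih₂ =>
    simp only [eval]
    rcases lt_trichotomy (k + 1) r with hr | hr | hr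
    · congr 1
      · exact ih₁ k hr _ _ (fun i hi => hleft _ hi) (fun i hi => hright _ hi)
          (fun i hi hi' => h _ hi hi')
      · congr 1
        funext j
        exact h _ (by simp only [Fin.val_natAdd]; omega) (by simp only [Fin.val_natAdd]; omega)
    · rw [t₂.eval_eq_mul_eval_of_first hx _ (fun j => b (Fin.natAdd _ j))
          (fun j hj => hright _ (by simp only [Fin.val_natAdd]; omega))
          (fun j hj => h _ (by simp only [Fin.val_natAdd]; omega)
            (by simp only [Fin.val_natAdd]; omega)),
        t₁.eval_eq_eval_mul_of_last hx (fun i => b (Fin.castAdd _ i))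
          (fun i => a (Fin.castAdd _ i))
          (fun i hi => hleft _ (by simp only [Fin.val_castAdd]; omega))
          (fun i hi => (h _ (by simp only [Fin.val_castAdd]; omega)
            (by have := i.isLt; simp only [Fin.val_castAdd]; omega)).symm), (hx _ _).2.1]
    · congr 1
      · congr 1
        funext j
        have := j.isLt
        exact h _ (by simp only [Fin.val_castAdd]; omega) (by simp only [Fin.val_castAdd]; omega)
      · exact ih₂ (k - r) (by omega) _ _
          (fun i hi => hleft _ (by simp only [Fin.val_natAdd]; omega))
          (fun i hi => hright _ (by simp only [Fin.val_natAdd]; omega))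
          (fun i hi hi' => h _ (by simp only [Fin.val_natAdd]; omega)
            (by simp only [Fin.val_natAdd]; omega))

end MulTree

open PaperQuasigroup in
/-- If two iterated products agree whenever the `m`-th argument is `1`, then they agree
whenever the `m`-th argument is any element of the nucleus `N(G)`. -/
theorem mulTree_eval_eq_of_eq_on_one {G : Type*} [PaperQuasigroup G] {n : ℕ}
    (p q : MulTree n) (m : Fin n)
    (h1 : ∀ args : Fin n → G,
      p.eval (Function.update args m 1) = q.eval (Function.update args m 1)) :
    ∀ (args : Fin n → G) (x : G), x ∈ nucleus G →
      p.eval (Function.update args m x) = q.eval (Function.update args m x) := by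
  intro args x hx
  rcases m with ⟨_ | k, hm⟩
  · have key (t : MulTree n) : t.eval (Function.update args ⟨0, hm⟩ x) =
        x * t.eval (Function.update args ⟨0, hm⟩ 1) := by
      refine t.eval_eq_mul_eval_of_first hx _ _ (fun i hi => ?_) (fun i hi => ?_)
      · obtain rfl : i = ⟨0, hm⟩ := Fin.ext hi
        simp [PaperQuasigroup.mul_one]
      · have hne : i ≠ ⟨0, hm⟩ := fun e => hi (congrArg Fin.val e)
        simp [hne]
    rw [key p, key q, h1]
  · have key (t : MulTree n) : t.eval (Function.update args ⟨k + 1, hm⟩ x) =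
        t.eval (Function.update
          (Function.update args ⟨k, by omega⟩ (args ⟨k, by omega⟩ * x)) ⟨k + 1, hm⟩ 1) := by
      refine t.eval_eq_eval_of_shift hx k hm _ _ (fun i hi => ?_) (fun i hi => ?_)
        (fun i hi hi' => ?_)
      · subst hi
        have hne : i ≠ ⟨i.val + 1, hm⟩ := fun e => by
          have := congrArg Fin.val e
          simp at this
        simp [hne]
      · obtain rfl : i = ⟨k + 1, hm⟩ := Fin.ext hi
        simp [PaperQuasigroup.mul_one]
      · have hne : i ≠ ⟨k, by omega⟩ := fun e => hi (congrArg Fin.val e)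
        have hne' : i ≠ ⟨k + 1, hm⟩ := fun e => hi' (congrArg Fin.val e)
        simp [hne, hne']
    rw [key p, key q, h1]
end

section
/- Let G be a quasiassociative quasigroup. Then the adjoint action is multiplicative: for all g, h ∈ G and all m ∈ N(G), Ad_{g·h}(m) = Ad_g(Ad_h(m)), i.e. ((g·h)·m)·(g·h)⁻¹ = (g·((h·m)·h⁻¹))·g⁻¹. -/
/-- The adjoint action `Ad_g(a) := (g·a)·g⁻¹`. -/
def PaperQuasigroup.Ad {G : Type*} [PaperQuasigroup G] (g a : G) : G := (g * a) * g⁻¹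

namespace PaperQuasigroup

variable {G : Type*} [PaperQuasigroup G]

theorem inv_mul_self (g : G) : g⁻¹ * g = 1 := by
  simpa only [PaperQuasigroup.mul_one] using inv_mul_cancel_left g 1

end PaperQuasigroup

open PaperQuasigroup in
/-- In a quasiassociative quasigroup the adjoint action on the nucleus is
multiplicative: `Ad_{g·h}(m) = Ad_g(Ad_h(m))`. -/
theorem quasiassociative_Ad_mul {G : Type*} [PaperQuasigroup G]
    (hG : IsQuasiassociative G) (g h m : G) (hm : m ∈ nucleus G) :
    ((g * h) * m) * (g * h)⁻¹ = (g * ((h * m) * h⁻¹)) * g⁻¹ := by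
  have ha := hG.2 h m hm
  have hah : ((h * m) * h⁻¹) * h = h * m := mul_inv_cancel_right h _
  generalize (h * m) * h⁻¹ = a at ha hah ⊢
  have hb := hG.2 g a ha
  have hbg : ((g * a) * g⁻¹) * g = g * a := mul_inv_cancel_right g _
  generalize (g * a) * g⁻¹ = b at hb hbg ⊢
  have key : (g * h) * m = b * (g * h) := by
    rw [(hm g h).2.2, ← hah, ← (ha g h).2.1, ← hbg, (hb g h).1]
  rw [key, mul_mul_inv_cancel]
end

section
/- Let G be a quasiassociative quasigroup. Then the target map of the 2-group construction preserves products: for all n, m ∈ N(G) and g, h ∈ G, (n·Ad_g(m))·(g·h) = (n·g)·(m·h). -/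
open PaperQuasigroup in
/-- The target map of the 2-group construction preserves products:
`(n·Ad_g(m))·(g·h) = (n·g)·(m·h)` for nucleus elements `n, m`. -/
theorem quasiassociative_target_preserves_product {G : Type*} [PaperQuasigroup G]
    (hG : IsQuasiassociative G) (n m g h : G)
    (hn : n ∈ nucleus G) (hm : m ∈ nucleus G) :
    (n * Ad g m) * (g * h) = (n * g) * (m * h) := by
  have hAd : Ad g m ∈ nucleus G := hG.2 g m hm
  have hcancel : Ad g m * g = g * m := PaperQuasigroup.mul_inv_cancel_right g (g * m)
  calc (n * Ad g m) * (g * h) = n * (Ad g m * (g * h)) := (hn _ _).1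
    _ = n * ((Ad g m * g) * h) := by rw [(hAd g h).1]
    _ = n * (g * (m * h)) := by rw [hcancel, (hm g h).2.1]
    _ = (n * g) * (m * h) := (hn _ _).1.symm
end

section
/- Let G be a quasiassociative quasigroup. Then the interchange law holds in N(G) ⋉ G: for all m₁', m₁, m₂', m₂ ∈ N(G) and g₁ ∈ G, m₁' · Ad_{m₁·g₁}(m₂') · m₁ · Ad_{g₁}(m₂) = m₁' · m₁ · Ad_{g₁}(m₂' · m₂). (All factors lie in the nucleus N(G), so the bracketing of these products is immaterial.) -/
namespace PaperQuasigroup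

variable {G : Type*} [PaperQuasigroup G]

theorem eq_of_mul_right_eq (g : G) {a b : G} (h : a * g = b * g) : a = b := by
  have key : ∀ c : G, (c * g) * g⁻¹ = c := fun c => by
    have hc := mul_inv_cancel_right g⁻¹ c
    rwa [inv_inv_eq] at hc
  rw [← key a, h, key b]

theorem Ad_mul_self (g a : G) : Ad g a * g = g * a := mul_inv_cancel_right g (g * a)

theorem Ad_mul (hG : IsQuasiassociative G) (g : G) {a b : G}
    (ha : a ∈ nucleus G) (hb : b ∈ nucleus G) : Ad g (a * b) = Ad g a * Ad g b := by
  have hA : Ad g a ∈ nucleus G := hG.2 g a ha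
  apply eq_of_mul_right_eq g
  rw [Ad_mul_self, (hA _ _).1, Ad_mul_self, ← (hb _ _).2.2, ← (hb _ _).2.2, Ad_mul_self]

theorem Ad_mul_left_mul (hG : IsQuasiassociative G) (g : G) {m a : G}
    (hm : m ∈ nucleus G) (ha : a ∈ nucleus G) : Ad (m * g) a * m = m * Ad g a := by
  have hA : Ad (m * g) a ∈ nucleus G := hG.2 (m * g) a ha
  apply eq_of_mul_right_eq g
  rw [(hA _ _).1, Ad_mul_self, (hm _ _).1, (hm _ _).1, Ad_mul_self]

end PaperQuasigroup

open PaperQuasigroup in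
/-- The interchange law in `N(G) ⋉ G` for a quasiassociative quasigroup:
`m₁' · Ad_{m₁·g₁}(m₂') · m₁ · Ad_{g₁}(m₂) = m₁' · m₁ · Ad_{g₁}(m₂' · m₂)`. -/
theorem quasiassociative_interchange {G : Type*} [PaperQuasigroup G]
    (hG : IsQuasiassociative G) (m₁' m₁ m₂' m₂ g₁ : G)
    (hm₁' : m₁' ∈ nucleus G) (hm₁ : m₁ ∈ nucleus G)
    (hm₂' : m₂' ∈ nucleus G) (hm₂ : m₂ ∈ nucleus G) :
    m₁' * Ad (m₁ * g₁) m₂' * m₁ * Ad g₁ m₂ = m₁' * m₁ * Ad g₁ (m₂' * m₂) := by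
  have hB : Ad g₁ m₂ ∈ nucleus G := hG.2 g₁ m₂ hm₂
  rw [Ad_mul hG g₁ hm₂' hm₂, (hm₁' _ _).1, Ad_mul_left_mul hG g₁ hm₁ hm₂',
    ← (hm₁' _ _).1, (hB _ _).2.2]
end

section
/- Let k be a field, A and B Hopf algebras over k with B commutative, and δ : A → B ⊗ A a left B-comodule structure making A both a left B-comodule algebra and a left B-comodule coalgebra. Then H := A ⊗ B is a Hopf algebra over k with: the tensor product algebra structure and unit 1_A ⊗ 1_B; comultiplication ▲(a ⊗ b) := Σ (a₍₁₎ ⊗ (a₍₂₎)₍₋₁₎ · b₍₁₎) ⊗ ((a₍₂₎)₍₀₎ ⊗ b₍₂₎); counit ε_H(a ⊗ b) := ε_A(a) ε_B(b); and antipode S_H(a ⊗ b) := S_A(a₍₀₎) ⊗ S_B(a₍₋₁₎ · b). That is, ▲ and ε_H are unital algebra maps, ▲ is coassociative with counit ε_H, and S_H is a two-sided convolution inverse of the identity of H. -/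
open TensorProduct

noncomputable section

/-- `δ : A → B ⊗ A` is a left `B`-comodule structure on `A`:
`(Δ_B ⊗ id_A) ∘ δ = (id_B ⊗ δ) ∘ δ` and `(ε_B ⊗ id_A) ∘ δ = id_A`. -/
def IsLeftCoaction (k B A : Type*) [Field k] [Ring B] [HopfAlgebra k B]
    [Ring A] [HopfAlgebra k A] (δ : A →ₗ[k] B ⊗[k] A) : Prop :=
  (∀ a : A, (TensorProduct.assoc k B B A)
      ((TensorProduct.map Coalgebra.comul LinearMap.id) (δ a))
    = (TensorProduct.map LinearMap.id δ) (δ a)) ∧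
  (∀ a : A, (TensorProduct.lid k A)
      ((TensorProduct.map Coalgebra.counit LinearMap.id) (δ a)) = a)

/-- `δ` makes `A` a left `B`-comodule algebra: it is a left coaction and a unital
algebra homomorphism into the tensor product algebra `B ⊗ A`. -/
def IsComoduleAlgebra (k B A : Type*) [Field k] [Ring B] [HopfAlgebra k B]
    [Ring A] [HopfAlgebra k A] (δ : A →ₗ[k] B ⊗[k] A) : Prop :=
  IsLeftCoaction k B A δ ∧ (∀ a a' : A, δ (a * a') = δ a * δ a') ∧ δ 1 = 1

/-- `δ` makes `A` a left `B`-comodule coalgebra: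
`a₍₋₁₎ ⊗ (a₍₀₎)₍₁₎ ⊗ (a₍₀₎)₍₂₎ = (a₍₁₎)₍₋₁₎(a₍₂₎)₍₋₁₎ ⊗ (a₍₁₎)₍₀₎ ⊗ (a₍₂₎)₍₀₎` and
`a₍₋₁₎ ε_A(a₍₀₎) = ε_A(a) 1_B`. -/
def IsComoduleCoalgebra (k B A : Type*) [Field k] [Ring B] [HopfAlgebra k B]
    [Ring A] [HopfAlgebra k A] (δ : A →ₗ[k] B ⊗[k] A) : Prop :=
  IsLeftCoaction k B A δ ∧
  (∀ a : A, (TensorProduct.map LinearMap.id Coalgebra.comul) (δ a)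
      = (TensorProduct.map (LinearMap.mul' k B) LinearMap.id)
          ((TensorProduct.tensorTensorTensorComm k B A B A)
            ((TensorProduct.map δ δ) (Coalgebra.comul a)))) ∧
  (∀ a : A, (TensorProduct.rid k B)
      ((TensorProduct.map LinearMap.id Coalgebra.counit) (δ a))
    = Coalgebra.counit (R := k) a • (1 : B))

/-- The comultiplication `▲` on `H = A ⊗ B`:
`▲(a ⊗ b) = Σ (a₍₁₎ ⊗ (a₍₂₎)₍₋₁₎·b₍₁₎) ⊗ ((a₍₂₎)₍₀₎ ⊗ b₍₂₎)`. -/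
def hComul (k B A : Type*) [Field k] [CommRing B] [HopfAlgebra k B]
    [Ring A] [HopfAlgebra k A] (δ : A →ₗ[k] B ⊗[k] A) :
    A ⊗[k] B →ₗ[k] (A ⊗[k] B) ⊗[k] (A ⊗[k] B) :=
  TensorProduct.map
      ((TensorProduct.map LinearMap.id (LinearMap.mul' k B)) ∘ₗ
        (TensorProduct.assoc k A B B).toLinearMap)
      LinearMap.id ∘ₗ
    (TensorProduct.tensorTensorTensorComm k (A ⊗[k] B) A B B).toLinearMap ∘ₗ
      TensorProduct.map (TensorProduct.assoc k A B A).symm.toLinearMap LinearMap.id ∘ₗ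
        TensorProduct.map (TensorProduct.map LinearMap.id δ) LinearMap.id ∘ₗ
          TensorProduct.map Coalgebra.comul Coalgebra.comul

/-- The counit `ε_H` on `H = A ⊗ B`: `ε_H(a ⊗ b) = ε_A(a)·ε_B(b)`. -/
def hCounit (k B A : Type*) [Field k] [CommRing B] [HopfAlgebra k B]
    [Ring A] [HopfAlgebra k A] : A ⊗[k] B →ₗ[k] k :=
  (TensorProduct.lid k k).toLinearMap ∘ₗ
    TensorProduct.map Coalgebra.counit Coalgebra.counit

/-- The antipode `S_H` on `H = A ⊗ B`: `S_H(a ⊗ b) = Σ S_A(a₍₀₎) ⊗ S_B(a₍₋₁₎·b)`. -/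
def hAntipode (k B A : Type*) [Field k] [CommRing B] [HopfAlgebra k B]
    [Ring A] [HopfAlgebra k A] (δ : A →ₗ[k] B ⊗[k] A) : A ⊗[k] B →ₗ[k] A ⊗[k] B :=
  TensorProduct.map (HopfAlgebra.antipode (R := k))
      (HopfAlgebra.antipode (R := k) ∘ₗ LinearMap.mul' k B) ∘ₗ
    (TensorProduct.assoc k A B B).toLinearMap ∘ₗ
      TensorProduct.map (TensorProduct.comm k B A).toLinearMap LinearMap.id ∘ₗ
        TensorProduct.map δ LinearMap.id

section SmashCoproduct

open Coalgebra

variable {k B A : Type*} [Field k] [CommRing B] [HopfAlgebra k B] [Ring A] [HopfAlgebra k A]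

/-- The map `u ⊗ v ↦ (u ⊗ v₍₋₁₎) ⊗ (v₍₀₎ ⊗ 1)`. -/
def coactRight (δ : A →ₐ[k] B ⊗[k] A) : A ⊗[k] A →ₐ[k] (A ⊗[k] B) ⊗[k] (A ⊗[k] B) :=
  (Algebra.TensorProduct.map (.id k (A ⊗[k] B)) Algebra.TensorProduct.includeLeft).comp
    ((Algebra.TensorProduct.assoc k k k A B A).symm.toAlgHom.comp
      (Algebra.TensorProduct.map (.id k A) δ))

/-- The map `p ⊗ q ↦ (1 ⊗ p) ⊗ (1 ⊗ q)`. -/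
def inclRight (k B A : Type*) [Field k] [CommRing B] [HopfAlgebra k B]
    [Ring A] [HopfAlgebra k A] : B ⊗[k] B →ₐ[k] (A ⊗[k] B) ⊗[k] (A ⊗[k] B) :=
  Algebra.TensorProduct.map Algebra.TensorProduct.includeRight
    Algebra.TensorProduct.includeRight

@[simp] lemma inclRight_tmul (p q : B) :
    inclRight k B A (p ⊗ₜ q) = (1 ⊗ₜ p) ⊗ₜ (1 ⊗ₜ q) := rfl

lemma coactRight_tmul (δ : A →ₐ[k] B ⊗[k] A) (u v : A) :
    coactRight δ (u ⊗ₜ v) =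
      Algebra.TensorProduct.map (.id k (A ⊗[k] B)) Algebra.TensorProduct.includeLeft
        ((Algebra.TensorProduct.assoc k k k A B A).symm (u ⊗ₜ δ v)) := rfl

lemma commute_coactRight_inclRight (δ : A →ₐ[k] B ⊗[k] A) (x : A ⊗[k] A) (y : B ⊗[k] B) :
    Commute (coactRight δ x) (inclRight k B A y) := by
  induction x with
  | zero => simp
  | add x x' hx hx' => rw [map_add]; exact hx.add_left hx'
  | tmul u v =>
    induction y with
    | zero => simp
    | add y y' hy hy' => rw [map_add]; exact hy.add_right hy'
    | tmul p q =>
      rw [coactRight_tmul]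
      generalize δ v = t
      induction t with
      | zero => simp
      | add t t' ht ht' => rw [tmul_add, map_add, map_add]; exact ht.add_left ht'
      | tmul z w => simp [Commute, SemiconjBy, mul_comm]

/-- The comultiplication of the smash coproduct, as an algebra homomorphism. -/
def hComulAlgHom (δ : A →ₐ[k] B ⊗[k] A) :
    A ⊗[k] B →ₐ[k] (A ⊗[k] B) ⊗[k] (A ⊗[k] B) :=
  Algebra.TensorProduct.lift ((coactRight δ).comp (Bialgebra.comulAlgHom k A))
    ((inclRight k B A).comp (Bialgebra.comulAlgHom k B))
    fun _ _ => commute_coactRight_inclRight δ _ _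

lemma hComulAlgHom_tmul (δ : A →ₐ[k] B ⊗[k] A) (a : A) (b : B) :
    hComulAlgHom δ (a ⊗ₜ b) = coactRight δ (comul a) * inclRight k B A (comul b) := rfl

lemma hComulAlgHom_tmul_one (δ : A →ₐ[k] B ⊗[k] A) (a : A) :
    hComulAlgHom δ (a ⊗ₜ 1) = coactRight δ (comul a) := by
  simp [hComulAlgHom_tmul]

lemma hComulAlgHom_one_tmul (δ : A →ₐ[k] B ⊗[k] A) (b : B) :
    hComulAlgHom δ (1 ⊗ₜ b) = inclRight k B A (comul b) := by
  simp [hComulAlgHom_tmul]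

lemma hComul_eq_hComulAlgHom (δ : A →ₐ[k] B ⊗[k] A) :
    hComul k B A δ.toLinearMap = (hComulAlgHom δ).toLinearMap := by
  refine TensorProduct.ext' fun a b => ?_
  rw [AlgHom.toLinearMap_apply, hComulAlgHom_tmul]
  simp only [hComul, LinearMap.comp_apply, map_tmul]
  generalize (comul a : A ⊗[k] A) = x
  generalize (comul b : B ⊗[k] B) = y
  induction x with
  | zero => simp
  | add x x' hx hx' => simp only [map_add, add_tmul, add_mul, hx, hx']
  | tmul u v =>
    induction y with
    | zero => simp
    | add y y' hy hy' => simp only [map_add, tmul_add, mul_add, hy, hy']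
    | tmul p q =>
      rw [coactRight_tmul]
      simp only [map_tmul, LinearMap.id_apply, AlgHom.toLinearMap_apply]
      generalize δ v = t
      induction t with
      | zero => simp
      | add t t' ht ht' => simp only [map_add, tmul_add, add_tmul, add_mul, ht, ht']
      | tmul z w => simp

/-- The counit of `A ⊗ B`, as an algebra homomorphism. -/
def hCounitAlgHom (k B A : Type*) [Field k] [CommRing B] [HopfAlgebra k B]
    [Ring A] [HopfAlgebra k A] : A ⊗[k] B →ₐ[k] k :=
  (Algebra.TensorProduct.lid k k).toAlgHom.comp
    (Algebra.TensorProduct.map (Bialgebra.counitAlgHom k A) (Bialgebra.counitAlgHom k B))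

lemma hCounit_eq_hCounitAlgHom :
    hCounit k B A = (hCounitAlgHom k B A).toLinearMap := rfl

@[simp] lemma hCounitAlgHom_tmul (a : A) (b : B) :
    hCounitAlgHom k B A (a ⊗ₜ b) = counit (R := k) a * counit (R := k) b := rfl

/-- The map `u ⊗ (v ⊗ w) ↦ (u ⊗ v₍₋₁₎w₍₋₂₎) ⊗ (v₍₀₎ ⊗ w₍₋₁₎) ⊗ (w₍₀₎ ⊗ 1)`. -/
def coactRightThree (δ : A →ₐ[k] B ⊗[k] A) :
    A ⊗[k] (A ⊗[k] A) →ₗ[k] (A ⊗[k] B) ⊗[k] ((A ⊗[k] B) ⊗[k] (A ⊗[k] B)) :=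
  (TensorProduct.assoc k _ _ _).toLinearMap ∘ₗ
    TensorProduct.map
      (LinearMap.mul' k _ ∘ₗ TensorProduct.map (coactRight δ).toLinearMap
        ((hComulAlgHom δ).comp Algebra.TensorProduct.includeRight).toLinearMap)
      (Algebra.TensorProduct.includeLeft : A →ₐ[k] A ⊗[k] B).toLinearMap ∘ₗ
    (TensorProduct.assoc k _ _ _).symm.toLinearMap ∘ₗ
    TensorProduct.map LinearMap.id δ.toLinearMap ∘ₗ
    (TensorProduct.assoc k _ _ _).symm.toLinearMap

lemma assoc_map_hComulAlgHom_coactRight (δ : A →ₐ[k] B ⊗[k] A) (x : A ⊗[k] A) :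
    Algebra.TensorProduct.assoc k k k (A ⊗[k] B) (A ⊗[k] B) (A ⊗[k] B)
      (Algebra.TensorProduct.map (hComulAlgHom δ) (.id k _) (coactRight δ x)) =
    coactRightThree δ (TensorProduct.assoc k A A A (comul.rTensor A x)) := by
  induction x with
  | zero => simp
  | add x x' hx hx' => simp only [map_add, hx, hx']
  | tmul u v =>
    rw [coactRight_tmul]
    simp only [coactRightThree, LinearMap.comp_apply, LinearEquiv.coe_coe,
      LinearMap.rTensor_tmul, LinearEquiv.symm_apply_apply, map_tmul, LinearMap.id_apply,
      AlgHom.toLinearMap_apply]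
    generalize δ v = t
    induction t with
    | zero => simp
    | add t t' ht ht' => simp only [map_add, tmul_add, ht, ht']
    | tmul z w =>
      have : (u ⊗ₜ[k] z : A ⊗[k] B) = u ⊗ₜ 1 * 1 ⊗ₜ z := by simp
      simp only [Algebra.TensorProduct.assoc_symm_tmul, TensorProduct.assoc_symm_tmul,
        Algebra.TensorProduct.map_tmul, map_tmul, LinearMap.comp_apply, LinearMap.mul'_apply,
        AlgHom.toLinearMap_apply, AlgHom.comp_apply, AlgHom.id_apply,
        Algebra.TensorProduct.includeLeft_apply, Algebra.TensorProduct.includeRight_apply]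
      rw [this, map_mul, hComulAlgHom_tmul_one]
      rfl

/-- The map `y ⊗ (v ⊗ w) ↦ (u ⊗ y) ⊗ (v ⊗ w₍₋₁₎) ⊗ (w₍₀₎ ⊗ 1)`. -/
def coactRightSpread (δ : A →ₐ[k] B ⊗[k] A) (u : A) :
    B ⊗[k] (A ⊗[k] A) →ₗ[k] (A ⊗[k] B) ⊗[k] ((A ⊗[k] B) ⊗[k] (A ⊗[k] B)) :=
  TensorProduct.map (TensorProduct.mk k A B u) (coactRight δ).toLinearMap

/-- The map `(y ⊗ v) ⊗ (z ⊗ (z' ⊗ w)) ↦ (u ⊗ yz) ⊗ (v ⊗ z') ⊗ (w ⊗ 1)`. -/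
def spreadThree (u : A) :
    (B ⊗[k] A) ⊗[k] (B ⊗[k] (B ⊗[k] A)) →ₗ[k]
      (A ⊗[k] B) ⊗[k] ((A ⊗[k] B) ⊗[k] (A ⊗[k] B)) :=
  LinearMap.mul' k _ ∘ₗ TensorProduct.map
    (TensorProduct.map (TensorProduct.mk k A B u)
      (Algebra.TensorProduct.includeLeft.comp
        (Algebra.TensorProduct.includeLeft : A →ₐ[k] A ⊗[k] B)).toLinearMap)
    (TensorProduct.map (Algebra.TensorProduct.includeRight : B →ₐ[k] A ⊗[k] B).toLinearMap
      (TensorProduct.map (Algebra.TensorProduct.includeRight : B →ₐ[k] A ⊗[k] B).toLinearMap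
        (Algebra.TensorProduct.includeLeft : A →ₐ[k] A ⊗[k] B).toLinearMap))

@[simp] lemma spreadThree_tmul (u v w : A) (y z z' : B) :
    spreadThree (k := k) u ((y ⊗ₜ v) ⊗ₜ (z ⊗ₜ (z' ⊗ₜ w))) =
      (u ⊗ₜ (y * z)) ⊗ₜ ((v ⊗ₜ z') ⊗ₜ (w ⊗ₜ 1)) := by
  simp [spreadThree]

lemma coactRightSpread_eq (δ : A →ₐ[k] B ⊗[k] A) (u : A) (s t : B ⊗[k] A) :
    coactRightSpread δ u (TensorProduct.map (LinearMap.mul' k B) LinearMap.id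
      (TensorProduct.tensorTensorTensorComm k B A B A (s ⊗ₜ t))) =
    spreadThree u (s ⊗ₜ TensorProduct.map LinearMap.id δ.toLinearMap t) := by
  induction s with
  | zero => simp
  | add s s' hs hs' => simp only [map_add, add_tmul, hs, hs']
  | tmul y v =>
    induction t with
    | zero => simp
    | add t t' ht ht' => simp only [map_add, tmul_add, ht, ht']
    | tmul z w =>
      simp only [tensorTensorTensorComm_tmul, map_tmul, LinearMap.mul'_apply,
        LinearMap.id_apply, coactRightSpread, mk_apply, AlgHom.toLinearMap_apply,
        coactRight_tmul]
      generalize δ w = t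
      induction t with
      | zero => simp
      | add t t' ht ht' => simp only [map_add, tmul_add, ht, ht']
      | tmul z' w' => simp

lemma coactRightThree_tmul (δ : A →ₐ[k] B ⊗[k] A)
    (hδ : IsLeftCoaction k B A δ.toLinearMap) (u v w : A) :
    coactRightThree δ (u ⊗ₜ (v ⊗ₜ w)) =
    spreadThree u (δ v ⊗ₜ TensorProduct.map LinearMap.id δ.toLinearMap (δ w)) := by
  have := hδ.1 w
  rw [AlgHom.toLinearMap_apply] at this
  rw [← this]
  simp only [coactRightThree, LinearMap.comp_apply, LinearEquiv.coe_coe,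
    TensorProduct.assoc_symm_tmul, map_tmul, LinearMap.id_apply, AlgHom.toLinearMap_apply]
  generalize δ w = t
  induction t with
  | zero => simp
  | add t t' ht ht' => simp only [map_add, tmul_add, ht, ht']
  | tmul z w =>
    simp only [TensorProduct.assoc_symm_tmul, map_tmul, LinearMap.comp_apply,
      LinearMap.mul'_apply, AlgHom.toLinearMap_apply, AlgHom.comp_apply, LinearMap.id_apply,
      Algebra.TensorProduct.includeLeft_apply, Algebra.TensorProduct.includeRight_apply,
      hComulAlgHom_one_tmul, coactRight_tmul]
    generalize δ v = s
    generalize (comul z : B ⊗[k] B) = y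
    induction s with
    | zero => simp
    | add s s' hs hs' => simp only [map_add, tmul_add, add_tmul, add_mul, hs, hs']
    | tmul p v =>
      induction y with
      | zero => simp
      | add y y' hy hy' => simp only [map_add, tmul_add, add_tmul, mul_add, hy, hy']
      | tmul z z' => simp

lemma map_hComulAlgHom_coactRight (δ : A →ₐ[k] B ⊗[k] A)
    (hδ : IsComoduleCoalgebra k B A δ.toLinearMap) (x : A ⊗[k] A) :
    Algebra.TensorProduct.map (.id k _) (hComulAlgHom δ) (coactRight δ x) =
    coactRightThree δ (comul.lTensor A x) := by
  obtain ⟨hcoact, hcomul, -⟩ := hδ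
  induction x with
  | zero => simp
  | add x x' hx hx' => simp only [map_add, hx, hx']
  | tmul u v =>
    trans coactRightSpread δ u (TensorProduct.map LinearMap.id comul (δ v))
    · rw [coactRight_tmul]
      generalize δ v = t
      induction t with
      | zero => simp
      | add t t' ht ht' => simp only [map_add, tmul_add, ht, ht']
      | tmul z w => simp [coactRightSpread, hComulAlgHom_tmul_one]
    · have := hcomul v
      rw [AlgHom.toLinearMap_apply] at this
      rw [this, LinearMap.lTensor_tmul]
      generalize (comul v : A ⊗[k] A) = y
      induction y with
      | zero => simp
      | add y y' hy hy' => simp only [map_add, tmul_add, hy, hy']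
      | tmul v w =>
        rw [map_tmul, coactRightSpread_eq, coactRightThree_tmul δ hcoact]
        rfl

lemma assoc_map_hComulAlgHom_inclRight (δ : A →ₐ[k] B ⊗[k] A) (y : B ⊗[k] B) :
    Algebra.TensorProduct.assoc k k k (A ⊗[k] B) (A ⊗[k] B) (A ⊗[k] B)
      (Algebra.TensorProduct.map (hComulAlgHom δ) (.id k _) (inclRight k B A y)) =
    Algebra.TensorProduct.map Algebra.TensorProduct.includeRight (inclRight k B A)
      (TensorProduct.assoc k B B B (comul.rTensor B y)) := by
  induction y with
  | zero => simp
  | add y y' hy hy' => simp only [map_add, hy, hy']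
  | tmul p q =>
    simp only [inclRight_tmul, Algebra.TensorProduct.map_tmul, hComulAlgHom_one_tmul,
      LinearMap.rTensor_tmul, AlgHom.id_apply]
    generalize (comul p : B ⊗[k] B) = t
    induction t with
    | zero => simp
    | add t t' ht ht' => simp only [map_add, add_tmul, ht, ht']
    | tmul z w => simp

lemma map_hComulAlgHom_inclRight (δ : A →ₐ[k] B ⊗[k] A) (y : B ⊗[k] B) :
    Algebra.TensorProduct.map (.id k _) (hComulAlgHom δ) (inclRight k B A y) =
    Algebra.TensorProduct.map Algebra.TensorProduct.includeRight (inclRight k B A)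
      (comul.lTensor B y) := by
  induction y with
  | zero => simp
  | add y y' hy hy' => simp only [map_add, hy, hy']
  | tmul p q => simp [hComulAlgHom_one_tmul]

lemma hComulAlgHom_coassoc (δ : A →ₐ[k] B ⊗[k] A)
    (hδ : IsComoduleCoalgebra k B A δ.toLinearMap) :
    (Algebra.TensorProduct.assoc k k k (A ⊗[k] B) (A ⊗[k] B) (A ⊗[k] B)).toAlgHom.comp
      ((Algebra.TensorProduct.map (hComulAlgHom δ) (.id k _)).comp (hComulAlgHom δ)) =
    (Algebra.TensorProduct.map (.id k _) (hComulAlgHom δ)).comp (hComulAlgHom δ) := by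
  refine Algebra.TensorProduct.ext (AlgHom.ext fun a => ?_) (AlgHom.ext fun b => ?_)
  · change Algebra.TensorProduct.assoc k k k _ _ _ (Algebra.TensorProduct.map _ _
      (hComulAlgHom δ (a ⊗ₜ 1))) = Algebra.TensorProduct.map _ _ (hComulAlgHom δ (a ⊗ₜ 1))
    rw [hComulAlgHom_tmul_one, assoc_map_hComulAlgHom_coactRight,
      map_hComulAlgHom_coactRight δ hδ, coassoc_apply]
  · change Algebra.TensorProduct.assoc k k k _ _ _ (Algebra.TensorProduct.map _ _
      (hComulAlgHom δ (1 ⊗ₜ b))) = Algebra.TensorProduct.map _ _ (hComulAlgHom δ (1 ⊗ₜ b))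
    rw [hComulAlgHom_one_tmul, assoc_map_hComulAlgHom_inclRight,
      map_hComulAlgHom_inclRight, coassoc_apply]

lemma lid_map_hCounitAlgHom_coactRight (δ : A →ₐ[k] B ⊗[k] A)
    (hδ : IsLeftCoaction k B A δ.toLinearMap) (x : A ⊗[k] A) :
    Algebra.TensorProduct.lid k (A ⊗[k] B)
      (Algebra.TensorProduct.map (hCounitAlgHom k B A) (.id k _) (coactRight δ x)) =
    TensorProduct.lid k A (counit.rTensor A x) ⊗ₜ 1 := by
  induction x with
  | zero => simp
  | add x x' hx hx' => simp only [map_add, add_tmul, hx, hx']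
  | tmul u v =>
    have := hδ.2 v
    rw [AlgHom.toLinearMap_apply] at this
    rw [coactRight_tmul, LinearMap.rTensor_tmul, TensorProduct.lid_tmul]
    nth_rw 2 [← this]
    generalize δ v = t
    induction t with
    | zero => simp
    | add t t' ht ht' => simp only [map_add, tmul_add, add_tmul, smul_add, ht, ht']
    | tmul z w => simp [mul_smul, smul_tmul']

lemma rid_map_hCounitAlgHom_coactRight (δ : A →ₐ[k] B ⊗[k] A)
    (hδ : IsComoduleCoalgebra k B A δ.toLinearMap) (x : A ⊗[k] A) :
    Algebra.TensorProduct.rid k k (A ⊗[k] B)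
      (Algebra.TensorProduct.map (.id k _) (hCounitAlgHom k B A) (coactRight δ x)) =
    TensorProduct.rid k A (counit.lTensor A x) ⊗ₜ 1 := by
  induction x with
  | zero => simp
  | add x x' hx hx' => simp only [map_add, add_tmul, hx, hx']
  | tmul u v =>
    have := hδ.2.2 v
    rw [AlgHom.toLinearMap_apply] at this
    rw [coactRight_tmul, LinearMap.lTensor_tmul, TensorProduct.rid_tmul, smul_tmul, ← this]
    generalize δ v = t
    induction t with
    | zero => simp
    | add t t' ht ht' => simp only [map_add, tmul_add, ht, ht']
    | tmul z w => simp

lemma lid_map_hCounitAlgHom_inclRight (y : B ⊗[k] B) :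
    Algebra.TensorProduct.lid k (A ⊗[k] B)
      (Algebra.TensorProduct.map (hCounitAlgHom k B A) (.id k _) (inclRight k B A y)) =
    1 ⊗ₜ TensorProduct.lid k B (counit.rTensor B y) := by
  induction y with
  | zero => simp
  | add y y' hy hy' => simp only [map_add, tmul_add, hy, hy']
  | tmul p q => simp

lemma rid_map_hCounitAlgHom_inclRight (y : B ⊗[k] B) :
    Algebra.TensorProduct.rid k k (A ⊗[k] B)
      (Algebra.TensorProduct.map (.id k _) (hCounitAlgHom k B A) (inclRight k B A y)) =
    1 ⊗ₜ TensorProduct.rid k B (counit.lTensor B y) := by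
  induction y with
  | zero => simp
  | add y y' hy hy' => simp only [map_add, tmul_add, hy, hy']
  | tmul p q => simp

lemma lid_map_hCounitAlgHom_hComulAlgHom (δ : A →ₐ[k] B ⊗[k] A)
    (hδ : IsLeftCoaction k B A δ.toLinearMap) :
    (Algebra.TensorProduct.lid k (A ⊗[k] B)).toAlgHom.comp
      ((Algebra.TensorProduct.map (hCounitAlgHom k B A) (.id k _)).comp (hComulAlgHom δ)) =
    .id k _ := by
  refine Algebra.TensorProduct.ext (AlgHom.ext fun a => ?_) (AlgHom.ext fun b => ?_)
  · change Algebra.TensorProduct.lid k _ (Algebra.TensorProduct.map _ _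
      (hComulAlgHom δ (a ⊗ₜ 1))) = a ⊗ₜ 1
    rw [hComulAlgHom_tmul_one, lid_map_hCounitAlgHom_coactRight δ hδ]
    simp
  · change Algebra.TensorProduct.lid k _ (Algebra.TensorProduct.map _ _
      (hComulAlgHom δ (1 ⊗ₜ b))) = 1 ⊗ₜ b
    rw [hComulAlgHom_one_tmul, lid_map_hCounitAlgHom_inclRight]
    simp

lemma rid_map_hCounitAlgHom_hComulAlgHom (δ : A →ₐ[k] B ⊗[k] A)
    (hδ : IsComoduleCoalgebra k B A δ.toLinearMap) :
    (Algebra.TensorProduct.rid k k (A ⊗[k] B)).toAlgHom.comp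
      ((Algebra.TensorProduct.map (.id k _) (hCounitAlgHom k B A)).comp (hComulAlgHom δ)) =
    .id k _ := by
  refine Algebra.TensorProduct.ext (AlgHom.ext fun a => ?_) (AlgHom.ext fun b => ?_)
  · change Algebra.TensorProduct.rid k k _ (Algebra.TensorProduct.map _ _
      (hComulAlgHom δ (a ⊗ₜ 1))) = a ⊗ₜ 1
    rw [hComulAlgHom_tmul_one, rid_map_hCounitAlgHom_coactRight δ hδ]
    simp
  · change Algebra.TensorProduct.rid k k _ (Algebra.TensorProduct.map _ _
      (hComulAlgHom δ (1 ⊗ₜ b))) = 1 ⊗ₜ b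
    rw [hComulAlgHom_one_tmul, rid_map_hCounitAlgHom_inclRight]
    simp

/-- The map `a ↦ S(a₍₀₎) ⊗ S(a₍₋₁₎)`, as a function of `δ a`. -/
def antipodeSwap (k B A : Type*) [Field k] [CommRing B] [HopfAlgebra k B]
    [Ring A] [HopfAlgebra k A] : B ⊗[k] A →ₗ[k] A ⊗[k] B :=
  TensorProduct.map (HopfAlgebra.antipode k) (HopfAlgebra.antipode k) ∘ₗ
    (TensorProduct.comm k B A).toLinearMap

@[simp] lemma antipodeSwap_tmul (z : B) (w : A) :
    antipodeSwap k B A (z ⊗ₜ w) = HopfAlgebra.antipode k w ⊗ₜ HopfAlgebra.antipode k z := rfl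

lemma hAntipode_tmul (δ : A →ₐ[k] B ⊗[k] A) (a : A) (b : B) :
    hAntipode k B A δ.toLinearMap (a ⊗ₜ b) =
      antipodeSwap k B A (δ a) * 1 ⊗ₜ HopfAlgebra.antipode k b := by
  simp only [hAntipode, LinearMap.comp_apply, map_tmul, AlgHom.toLinearMap_apply]
  generalize δ a = t
  induction t with
  | zero => simp
  | add t t' ht ht' => simp only [map_add, add_tmul, add_mul, ht, ht']
  | tmul z w => simp [HopfAlgebra.antipode_mul_antidistrib, mul_comm]

/-- The map `z ⊗ (u ⊗ v) ↦ S(u)v ⊗ S(z)`. -/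
def antipodeContract (k B A : Type*) [Field k] [CommRing B] [HopfAlgebra k B]
    [Ring A] [HopfAlgebra k A] : B ⊗[k] (A ⊗[k] A) →ₗ[k] A ⊗[k] B :=
  TensorProduct.map (LinearMap.mul' k A ∘ₗ (HopfAlgebra.antipode k).rTensor A)
    (HopfAlgebra.antipode k) ∘ₗ (TensorProduct.comm k B (A ⊗[k] A)).toLinearMap

lemma mul_hAntipode_rTensor_mul (δ : A →ₐ[k] B ⊗[k] A) (x : A ⊗[k] A) (y : B ⊗[k] B) :
    LinearMap.mul' k (A ⊗[k] B) (TensorProduct.map (hAntipode k B A δ.toLinearMap)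
      LinearMap.id (coactRight δ x * inclRight k B A y)) =
    antipodeContract k B A (TensorProduct.map (LinearMap.mul' k B) LinearMap.id
      (TensorProduct.tensorTensorTensorComm k B A B A
        (TensorProduct.map δ.toLinearMap δ.toLinearMap x))) *
      1 ⊗ₜ LinearMap.mul' k B ((HopfAlgebra.antipode k).rTensor B y) := by
  induction x with
  | zero => simp
  | add x x' hx hx' => simp only [map_add, add_mul, hx, hx']
  | tmul u v =>
    induction y with
    | zero => simp
    | add y y' hy hy' => simp only [map_add, tmul_add, mul_add, hy, hy']
    | tmul p q =>
      rw [coactRight_tmul]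
      simp only [map_tmul, AlgHom.toLinearMap_apply]
      generalize δ v = t
      induction t with
      | zero => simp
      | add t t' ht ht' => simp only [map_add, tmul_add, add_mul, ht, ht']
      | tmul z w =>
        simp only [Algebra.TensorProduct.assoc_symm_tmul, Algebra.TensorProduct.map_tmul,
          Algebra.TensorProduct.includeLeft_apply, AlgHom.id_apply, inclRight_tmul,
          Algebra.TensorProduct.tmul_mul_tmul, map_tmul, LinearMap.mul'_apply, mul_one,
          one_mul, LinearMap.id_apply, hAntipode_tmul]
        generalize δ u = s
        induction s with
        | zero => simp
        | add s s' hs hs' => simp only [map_add, add_tmul, add_mul, hs, hs']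
        | tmul z' w' =>
          simp [antipodeContract, HopfAlgebra.antipode_mul_antidistrib]
          congr 1
          ring

lemma antipodeContract_map_comul (t : B ⊗[k] A) :
    antipodeContract k B A (TensorProduct.map LinearMap.id comul t) =
      1 ⊗ₜ HopfAlgebra.antipode k
        (TensorProduct.rid k B (TensorProduct.map LinearMap.id counit t)) := by
  induction t with
  | zero => simp
  | add t t' ht ht' => simp only [map_add, tmul_add, ht, ht']
  | tmul z w =>
    simp [antipodeContract, HopfAlgebra.mul_antipode_rTensor_comul_apply,
      Algebra.algebraMap_eq_smul_one, smul_tmul]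

/-- The map `y ⊗ (z ⊗ w) ↦ S(w) ⊗ yS(z)`. -/
def contractAntipode (k B A : Type*) [Field k] [CommRing B] [HopfAlgebra k B]
    [Ring A] [HopfAlgebra k A] : B ⊗[k] (B ⊗[k] A) →ₗ[k] A ⊗[k] B :=
  LinearMap.mul' k (A ⊗[k] B) ∘ₗ TensorProduct.map
    (Algebra.TensorProduct.includeRight : B →ₐ[k] A ⊗[k] B).toLinearMap (antipodeSwap k B A)

lemma contractAntipode_assoc_map_comul (t : B ⊗[k] A) :
    contractAntipode k B A (TensorProduct.assoc k B B A
      (TensorProduct.map comul LinearMap.id t)) =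
    HopfAlgebra.antipode k (TensorProduct.lid k A
      (TensorProduct.map counit LinearMap.id t)) ⊗ₜ 1 := by
  induction t with
  | zero => simp
  | add t t' ht ht' => simp only [map_add, add_tmul, ht, ht']
  | tmul z w =>
    trans HopfAlgebra.antipode k w ⊗ₜ
      LinearMap.mul' k B ((HopfAlgebra.antipode k).lTensor B (comul z))
    · rw [map_tmul]
      generalize (comul z : B ⊗[k] B) = y
      induction y with
      | zero => simp
      | add y y' hy hy' => simp only [map_add, add_tmul, tmul_add, hy, hy']
      | tmul p q => simp [contractAntipode]
    · simp [HopfAlgebra.mul_antipode_lTensor_comul_apply, Algebra.algebraMap_eq_smul_one,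
        smul_tmul']

lemma mul_hAntipode_lTensor_mul (δ : A →ₐ[k] B ⊗[k] A)
    (hδ : IsLeftCoaction k B A δ.toLinearMap) (x : A ⊗[k] A) (y : B ⊗[k] B) :
    LinearMap.mul' k (A ⊗[k] B) (TensorProduct.map LinearMap.id
      (hAntipode k B A δ.toLinearMap) (coactRight δ x * inclRight k B A y)) =
    LinearMap.mul' k A ((HopfAlgebra.antipode k).lTensor A x) ⊗ₜ
      LinearMap.mul' k B ((HopfAlgebra.antipode k).lTensor B y) := by
  induction x with
  | zero => simp
  | add x x' hx hx' => simp only [map_add, add_mul, add_tmul, hx, hx']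
  | tmul u v =>
    induction y with
    | zero => simp
    | add y y' hy hy' => simp only [map_add, tmul_add, mul_add, hy, hy']
    | tmul p q =>
      trans u ⊗ₜ p * contractAntipode k B A
        (TensorProduct.map LinearMap.id δ.toLinearMap (δ v)) * 1 ⊗ₜ HopfAlgebra.antipode k q
      · rw [coactRight_tmul]
        generalize δ v = t
        induction t with
        | zero => simp
        | add t t' ht ht' => simp only [map_add, tmul_add, mul_add, add_mul, ht, ht']
        | tmul z w =>
          simp only [Algebra.TensorProduct.assoc_symm_tmul, Algebra.TensorProduct.map_tmul,
            Algebra.TensorProduct.includeLeft_apply, AlgHom.id_apply, inclRight_tmul,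
            Algebra.TensorProduct.tmul_mul_tmul, map_tmul, LinearMap.mul'_apply, mul_one,
            one_mul, LinearMap.id_apply, hAntipode_tmul, contractAntipode,
            LinearMap.comp_apply, AlgHom.toLinearMap_apply,
            Algebra.TensorProduct.includeRight_apply, ← mul_assoc, mul_comm z p]
      · have h₁ := hδ.1 v
        have h₂ := hδ.2 v
        rw [AlgHom.toLinearMap_apply] at h₁ h₂
        rw [← h₁, contractAntipode_assoc_map_comul, h₂]
        simp

lemma algebraMap_hCounit_tmul (a : A) (b : B) :
    algebraMap k (A ⊗[k] B) (hCounit k B A (a ⊗ₜ b)) =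
      algebraMap k A (counit a) ⊗ₜ algebraMap k B (counit b) := by
  simp [hCounit_eq_hCounitAlgHom, Algebra.algebraMap_eq_smul_one, smul_tmul', smul_smul,
    Algebra.TensorProduct.one_def, mul_comm]

lemma mul_hAntipode_rTensor_hComulAlgHom (δ : A →ₐ[k] B ⊗[k] A)
    (hδ : IsComoduleCoalgebra k B A δ.toLinearMap) (x : A ⊗[k] B) :
    LinearMap.mul' k (A ⊗[k] B) (TensorProduct.map (hAntipode k B A δ.toLinearMap)
      LinearMap.id (hComulAlgHom δ x)) = algebraMap k (A ⊗[k] B) (hCounit k B A x) := by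
  induction x with
  | zero => simp
  | add x x' hx hx' => simp only [map_add, hx, hx']
  | tmul a b =>
    rw [hComulAlgHom_tmul, mul_hAntipode_rTensor_mul, ← hδ.2.1, antipodeContract_map_comul,
      hδ.2.2, HopfAlgebra.mul_antipode_rTensor_comul_apply, algebraMap_hCounit_tmul]
    simp [Algebra.algebraMap_eq_smul_one, smul_tmul]

lemma mul_hAntipode_lTensor_hComulAlgHom (δ : A →ₐ[k] B ⊗[k] A)
    (hδ : IsLeftCoaction k B A δ.toLinearMap) (x : A ⊗[k] B) :
    LinearMap.mul' k (A ⊗[k] B) (TensorProduct.map LinearMap.id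
      (hAntipode k B A δ.toLinearMap) (hComulAlgHom δ x)) =
    algebraMap k (A ⊗[k] B) (hCounit k B A x) := by
  induction x with
  | zero => simp
  | add x x' hx hx' => simp only [map_add, hx, hx']
  | tmul a b =>
    rw [hComulAlgHom_tmul, mul_hAntipode_lTensor_mul δ hδ,
      HopfAlgebra.mul_antipode_lTensor_comul_apply,
      HopfAlgebra.mul_antipode_lTensor_comul_apply, algebraMap_hCounit_tmul]

end SmashCoproduct

/-- If `B` is commutative and `δ` makes `A` a left `B`-comodule algebra and comodule
coalgebra, then `H = A ⊗ B` with the tensor product algebra structure, comultiplication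
`▲`, counit `ε_H`, and antipode `S_H` is a Hopf algebra: `▲` and `ε_H` are unital
algebra maps, `▲` is coassociative with counit `ε_H`, and `S_H` is a two-sided
convolution inverse of the identity. -/
theorem tensor_hopfAlgebra (k B A : Type*) [Field k] [CommRing B] [HopfAlgebra k B]
    [Ring A] [HopfAlgebra k A] (δ : A →ₗ[k] B ⊗[k] A)
    (halg : IsComoduleAlgebra k B A δ) (hcoalg : IsComoduleCoalgebra k B A δ) :
    (∀ x y : A ⊗[k] B, hComul k B A δ (x * y) = hComul k B A δ x * hComul k B A δ y) ∧
    (hComul k B A δ 1 = 1) ∧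
    (∀ x y : A ⊗[k] B, hCounit k B A (x * y) = hCounit k B A x * hCounit k B A y) ∧
    (hCounit k B A (1 : A ⊗[k] B) = 1) ∧
    (∀ x : A ⊗[k] B,
      (TensorProduct.assoc k (A ⊗[k] B) (A ⊗[k] B) (A ⊗[k] B))
          ((TensorProduct.map (hComul k B A δ) LinearMap.id) (hComul k B A δ x))
        = (TensorProduct.map LinearMap.id (hComul k B A δ)) (hComul k B A δ x)) ∧
    (∀ x : A ⊗[k] B,
      (TensorProduct.lid k (A ⊗[k] B))
          ((TensorProduct.map (hCounit k B A) LinearMap.id) (hComul k B A δ x)) = x) ∧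
    (∀ x : A ⊗[k] B,
      (TensorProduct.rid k (A ⊗[k] B))
          ((TensorProduct.map LinearMap.id (hCounit k B A)) (hComul k B A δ x)) = x) ∧
    (∀ x : A ⊗[k] B,
      LinearMap.mul' k (A ⊗[k] B)
          ((TensorProduct.map (hAntipode k B A δ) LinearMap.id) (hComul k B A δ x))
        = algebraMap k (A ⊗[k] B) (hCounit k B A x)) ∧
    (∀ x : A ⊗[k] B,
      LinearMap.mul' k (A ⊗[k] B)
          ((TensorProduct.map LinearMap.id (hAntipode k B A δ)) (hComul k B A δ x))
        = algebraMap k (A ⊗[k] B) (hCounit k B A x)) := by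
  obtain ⟨δ, rfl⟩ : ∃ δ' : A →ₐ[k] B ⊗[k] A, δ'.toLinearMap = δ :=
    ⟨AlgHom.ofLinearMap δ halg.2.2 halg.2.1, rfl⟩
  rw [hComul_eq_hComulAlgHom, hCounit_eq_hCounitAlgHom]
  exact ⟨map_mul (hComulAlgHom δ), map_one (hComulAlgHom δ), map_mul (hCounitAlgHom k B A),
    map_one (hCounitAlgHom k B A), DFunLike.congr_fun (hComulAlgHom_coassoc δ hcoalg),
    DFunLike.congr_fun (lid_map_hCounitAlgHom_hComulAlgHom δ hcoalg.1),
    DFunLike.congr_fun (rid_map_hCounitAlgHom_hComulAlgHom δ hcoalg),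
    mul_hAntipode_rTensor_hComulAlgHom δ hcoalg,
    mul_hAntipode_lTensor_hComulAlgHom δ hcoalg.1⟩

end
end

section
/- Let k be a field, A and B Hopf algebras over k with B commutative, φ : B → A a Hopf algebra morphism, and δ : A → B ⊗ A a left B-comodule structure making A both a left B-comodule algebra and a left B-comodule coalgebra, and satisfying δ(φ(b)) = Σ b₍₁₎ · S_B(b₍₃₎) ⊗ φ(b₍₂₎) for all b ∈ B. Let ▲ be the comultiplication on A ⊗ B given by ▲(a ⊗ b) := Σ (a₍₁₎ ⊗ (a₍₂₎)₍₋₁₎ · b₍₁₎) ⊗ ((a₍₂₎)₍₀₎ ⊗ b₍₂₎), with counit ε_H(a ⊗ b) := ε_A(a) ε_B(b). Then the source map s : B → A ⊗ B, s(b) := Σ φ(b₍₁₎) ⊗ b₍₂₎, is a coalgebra map: ▲(s(b)) = Σ s(b₍₁₎) ⊗ s(b₍₂₎) and ε_H(s(b)) = ε_B(b) for all b ∈ B. -/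
open TensorProduct

noncomputable section

/-- The map `b ↦ Σ b₍₁₎ · S(b₍₃₎) ⊗ b₍₂₎` on a Hopf algebra. -/
def adMap (k B : Type*) [Field k] [Ring B] [HopfAlgebra k B] : B →ₗ[k] B ⊗[k] B :=
  TensorProduct.map
      (LinearMap.mul' k B ∘ₗ
        TensorProduct.map LinearMap.id (HopfAlgebra.antipode (R := k)))
      LinearMap.id ∘ₗ
    (TensorProduct.assoc k B B B).symm.toLinearMap ∘ₗ
      (TensorProduct.map LinearMap.id (TensorProduct.comm k B B).toLinearMap) ∘ₗ
        (TensorProduct.assoc k B B B).toLinearMap ∘ₗ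
          (TensorProduct.map Coalgebra.comul LinearMap.id) ∘ₗ Coalgebra.comul

section SourceMap

variable {k B A : Type*} [Field k] [CommRing B] [HopfAlgebra k B] [Ring A] [HopfAlgebra k A]

/-- Coassociativity in fourfold form: `Δ(b₍₁₎) ⊗ Δ(b₍₂₎) = b₍₁₎ ⊗ Δ(b₍₂₎) ⊗ b₍₃₎`. -/
lemma assoc_map_comul_comul {C : Type*} [AddCommMonoid C] [Module k C] [Coalgebra k C] (b : C) :
    TensorProduct.assoc k C C (C ⊗[k] C)
        (TensorProduct.map Coalgebra.comul Coalgebra.comul (Coalgebra.comul (R := k) b)) =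
      TensorProduct.map LinearMap.id
        ((TensorProduct.assoc k C C C).toLinearMap ∘ₗ
          TensorProduct.map Coalgebra.comul LinearMap.id ∘ₗ Coalgebra.comul)
        (Coalgebra.comul (R := k) b) := by
  have natural : ∀ t : C ⊗[k] C,
      TensorProduct.assoc k C C (C ⊗[k] C)
          (TensorProduct.map Coalgebra.comul Coalgebra.comul t) =
        TensorProduct.map LinearMap.id (TensorProduct.map LinearMap.id Coalgebra.comul)
          (TensorProduct.assoc k C C C (Coalgebra.comul.rTensor C t)) := by
    intro t
    induction t with
    | zero => simp
    | add x y hx hy => simp only [map_add, hx, hy]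
    | tmul x y =>
      simp only [TensorProduct.map_tmul, LinearMap.rTensor_tmul]
      generalize Coalgebra.comul (R := k) x = u
      induction u with
      | zero => simp
      | add x y hx hy => simp only [map_add, TensorProduct.add_tmul, hx, hy]
      | tmul x z => simp
  rw [natural, Coalgebra.coassoc_apply, LinearMap.lTensor, TensorProduct.map_map, LinearMap.id_comp]
  congr 2
  exact Coalgebra.coassoc.symm

/-- The map `(u ⊗ v) ⊗ z ↦ u z ⊗ v`. -/
def mulOuter (k B : Type*) [Field k] [CommRing B] [HopfAlgebra k B] :
    (B ⊗[k] B) ⊗[k] B →ₗ[k] B ⊗[k] B :=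
  TensorProduct.map (LinearMap.mul' k B) LinearMap.id ∘ₗ
    (TensorProduct.rightComm k B B B).toLinearMap

@[simp]
lemma mulOuter_tmul (u v z : B) : mulOuter k B ((u ⊗ₜ v) ⊗ₜ z) = (u * z) ⊗ₜ[k] v := by
  simp [mulOuter]

lemma adMap_eq_mulOuter (b : B) :
    adMap k B b = mulOuter k B
      (TensorProduct.map Coalgebra.comul (HopfAlgebra.antipode k (A := B))
        (Coalgebra.comul (R := k) b)) := by
  simp only [adMap, LinearMap.comp_apply]
  generalize Coalgebra.comul (R := k) b = t
  induction t with
  | zero => simp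
  | add x y hx hy => simp only [map_add, hx, hy]
  | tmul x y =>
    simp only [TensorProduct.map_tmul]
    generalize Coalgebra.comul (R := k) x = u
    induction u with
    | zero => simp
    | add x y hx hy => simp only [map_add, TensorProduct.add_tmul, hx, hy]
    | tmul x z => simp

/-- `b₍₁₎ S(b₍₃₎) b₍₄₎ ⊗ b₍₂₎ = b₍₁₎ ⊗ b₍₂₎`. -/
lemma mulOuter_map_adMap_comul (b : B) :
    mulOuter k B (TensorProduct.map (adMap k B) LinearMap.id (Coalgebra.comul (R := k) b)) =
      Coalgebra.comul (R := k) b := by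
  have regroup : ∀ t : (B ⊗[k] B) ⊗[k] B,
      mulOuter k B (TensorProduct.map
          (mulOuter k B ∘ₗ TensorProduct.map Coalgebra.comul (HopfAlgebra.antipode k (A := B)))
          LinearMap.id t) =
        mulOuter k B (TensorProduct.map Coalgebra.comul
          (LinearMap.mul' k B ∘ₗ LinearMap.rTensor B (HopfAlgebra.antipode k (A := B)))
          (TensorProduct.assoc k B B B t)) := by
    intro t
    induction t with
    | zero => simp
    | add x y hx hy => simp only [map_add, hx, hy]
    | tmul xy z =>
      induction xy with
      | zero => simp
      | add x y hx hy => simp only [map_add, TensorProduct.add_tmul, hx, hy]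
      | tmul x y =>
        simp only [TensorProduct.map_tmul, LinearMap.comp_apply, TensorProduct.assoc_tmul,
          LinearMap.rTensor_tmul, LinearMap.mul'_apply, LinearMap.id_apply]
        generalize Coalgebra.comul (R := k) x = u
        induction u with
        | zero => simp
        | add x y hx hy => simp only [map_add, TensorProduct.add_tmul, hx, hy]
        | tmul x w => simp [mul_assoc]
  have adMap_eq : adMap k B =
      (mulOuter k B ∘ₗ TensorProduct.map Coalgebra.comul (HopfAlgebra.antipode k (A := B))) ∘ₗ
        Coalgebra.comul := LinearMap.ext adMap_eq_mulOuter
  have unit_right : ∀ u : B ⊗[k] B, mulOuter k B (u ⊗ₜ 1) = u := by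
    intro u
    induction u with
    | zero => simp
    | add x y hx hy => simp only [map_add, TensorProduct.add_tmul, hx, hy]
    | tmul x y => simp
  calc
    _ = mulOuter k B (TensorProduct.map
          (mulOuter k B ∘ₗ TensorProduct.map Coalgebra.comul (HopfAlgebra.antipode k (A := B)))
          LinearMap.id (Coalgebra.comul.rTensor B (Coalgebra.comul (R := k) b))) := by
      rw [adMap_eq, LinearMap.rTensor, TensorProduct.map_map, LinearMap.id_comp]
    _ = mulOuter k B (TensorProduct.map Coalgebra.comul
          ((LinearMap.mul' k B ∘ₗ LinearMap.rTensor B (HopfAlgebra.antipode k (A := B))) ∘ₗ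
            Coalgebra.comul) (Coalgebra.comul (R := k) b)) := by
      rw [regroup, Coalgebra.coassoc_apply, LinearMap.lTensor,
        TensorProduct.map_map,
        LinearMap.comp_id]
    _ = mulOuter k B (TensorProduct.map Coalgebra.comul (Algebra.linearMap k B)
          (Coalgebra.counit.lTensor B (Coalgebra.comul (R := k) b))) := by
      rw [LinearMap.comp_assoc, HopfAlgebra.mul_antipode_rTensor_comul, LinearMap.lTensor,
        TensorProduct.map_map,
        LinearMap.comp_id]
    _ = _ := by
      rw [Coalgebra.lTensor_counit_comul, TensorProduct.map_tmul]
      simp [unit_right]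

/-- The map `x ⊗ ((u ⊗ v) ⊗ w) ↦ (f(x) ⊗ u) ⊗ (f(v) ⊗ w)`. -/
def regroupMap (f : B →ₗ[k] A) :
    B ⊗[k] ((B ⊗[k] B) ⊗[k] B) →ₗ[k] (A ⊗[k] B) ⊗[k] (A ⊗[k] B) :=
  TensorProduct.map (TensorProduct.map f LinearMap.id) (TensorProduct.map f LinearMap.id) ∘ₗ
    (TensorProduct.assoc k B B (B ⊗[k] B)).symm.toLinearMap ∘ₗ
      TensorProduct.map LinearMap.id (TensorProduct.assoc k B B B).toLinearMap

lemma hComul_map_apply (φ : B →ₐc[k] A) (δ : A →ₗ[k] B ⊗[k] A)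
    (hδφ : ∀ b : B,
      δ (φ b) = (TensorProduct.map LinearMap.id φ.toLinearMap) (adMap k B b)) (t : B ⊗[k] B) :
    hComul k B A δ (TensorProduct.map φ.toLinearMap LinearMap.id t) =
      regroupMap φ.toLinearMap (TensorProduct.map LinearMap.id
        (TensorProduct.map (mulOuter k B ∘ₗ TensorProduct.map (adMap k B) LinearMap.id)
          LinearMap.id ∘ₗ (TensorProduct.assoc k B B B).symm.toLinearMap)
        (TensorProduct.assoc k B B (B ⊗[k] B)
          (TensorProduct.map Coalgebra.comul Coalgebra.comul t))) := by
  induction t with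
  | zero => simp
  | add x y hx hy => simp only [map_add, hx, hy]
  | tmul x y =>
    have comul_map : Coalgebra.comul (R := k) (φ.toLinearMap x) =
        TensorProduct.map φ.toLinearMap φ.toLinearMap (Coalgebra.comul (R := k) x) :=
      (CoalgHomClass.map_comp_comul_apply φ x).symm
    simp only [hComul, LinearMap.comp_apply, TensorProduct.map_tmul, comul_map,
      LinearMap.id_apply]
    generalize Coalgebra.comul (R := k) x = u
    generalize Coalgebra.comul (R := k) y = v
    induction u with
    | zero => simp
    | add x y hx hy => simp only [map_add, TensorProduct.add_tmul, hx, hy]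
    | tmul x y =>
      have coaction_map : δ (φ.toLinearMap y) =
          TensorProduct.map LinearMap.id φ.toLinearMap (adMap k B y) := hδφ y
      induction v with
      | zero => simp
      | add x y hx hy => simp only [map_add, TensorProduct.tmul_add, hx, hy]
      | tmul z w =>
        simp only [TensorProduct.map_tmul, LinearMap.id_apply, coaction_map,
          LinearEquiv.coe_coe, TensorProduct.assoc_tmul, LinearMap.comp_apply,
          TensorProduct.assoc_symm_tmul]
        generalize adMap k B y = a
        induction a with
        | zero => simp
        | add x y hx hy =>
          simp only [map_add, TensorProduct.add_tmul, TensorProduct.tmul_add, hx, hy]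
        | tmul p q => simp [regroupMap]

end SourceMap

/-- If `φ : B → A` is a Hopf algebra morphism, `B` is commutative, `δ` makes `A` a left
`B`-comodule algebra and comodule coalgebra with `δ(φ(b)) = Σ b₍₁₎·S_B(b₍₃₎) ⊗ φ(b₍₂₎)`,
then the source map `s(b) := Σ φ(b₍₁₎) ⊗ b₍₂₎ : B → A ⊗ B` is a coalgebra map with
respect to `▲` and `ε_H`. -/
theorem source_map_is_coalgebra_map (k B A : Type*) [Field k] [CommRing B]
    [HopfAlgebra k B] [Ring A] [HopfAlgebra k A] (φ : B →ₐc[k] A)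
    (δ : A →ₗ[k] B ⊗[k] A)
    (halg : IsComoduleAlgebra k B A δ) (hcoalg : IsComoduleCoalgebra k B A δ)
    (hδφ : ∀ b : B,
      δ (φ b) = (TensorProduct.map LinearMap.id φ.toLinearMap) (adMap k B b)) :
    let s : B →ₗ[k] A ⊗[k] B :=
      TensorProduct.map φ.toLinearMap LinearMap.id ∘ₗ Coalgebra.comul
    (∀ b : B, hComul k B A δ (s b) = (TensorProduct.map s s) (Coalgebra.comul b)) ∧
    (∀ b : B, hCounit k B A (s b) = Coalgebra.counit (R := k) b) := by
  intro s
  refine ⟨fun b => ?_, fun b => ?_⟩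
  · have collapse : (TensorProduct.map
          (mulOuter k B ∘ₗ TensorProduct.map (adMap k B) LinearMap.id) LinearMap.id ∘ₗ
            (TensorProduct.assoc k B B B).symm.toLinearMap) ∘ₗ
          ((TensorProduct.assoc k B B B).toLinearMap ∘ₗ
            TensorProduct.map Coalgebra.comul LinearMap.id ∘ₗ Coalgebra.comul) =
        TensorProduct.map Coalgebra.comul LinearMap.id ∘ₗ Coalgebra.comul (R := k) (A := B) := by
      ext c
      simp only [LinearMap.comp_apply, LinearEquiv.coe_coe, LinearEquiv.symm_apply_apply]
      rw [TensorProduct.map_map]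
      congr 2
      ext d
      exact mulOuter_map_adMap_comul d
    simp only [s, LinearMap.comp_apply]
    rw [hComul_map_apply φ δ hδφ, assoc_map_comul_comul,
      TensorProduct.map_map, collapse,
      LinearMap.id_comp, regroupMap, LinearMap.comp_apply, LinearMap.comp_apply,
      TensorProduct.map_map,
      LinearMap.id_comp, ← assoc_map_comul_comul, LinearEquiv.coe_coe,
      LinearEquiv.symm_apply_apply, TensorProduct.map_map]
  · have counit_map : Coalgebra.counit (R := k) ∘ₗ φ.toLinearMap = Coalgebra.counit :=
      CoalgHomClass.counit_comp φ
    simp only [s, hCounit, LinearMap.comp_apply]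
    rw [TensorProduct.map_map, counit_map,
      LinearMap.comp_id, ← LinearMap.lTensor_comp_rTensor, LinearMap.comp_apply,
      Coalgebra.rTensor_counit_comul]
    simp

end
end
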